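/- arXiv:1605.06049 — 3 statements merged into one kernel-verified Lean document; each statement's English description precedes it below -/
import Mathlib

section
/- (Lemma 3.3, nonconvex case.) Let d ≥ 1, m ≥ 1 be integers and ε > 0, Λ_O > 0 constants. There exist constants 0 < μ₁ ≤ μ₂, depending only on d, m, ε, Λ_O, with the following property: for every finite sequence of pairs (s₁, y₁), …, (s_m, y_m) in ℝ^d × ℝ^d satisfying for each j that s_j ≠ 0, y_jᵀs_j ≥ ε·‖s_j‖², and ‖y_j‖ ≤ Λ_O·‖s_j‖, the matrices defined recursively by B^{(0)} = (‖y_m‖²/(y_mᵀs_m))·I and B^{(i+1)} = B^{(i)} − (B^{(i)} s_{i+1} s_{i+1}ᵀ B^{(i)})/(s_{i+1}ᵀ B^{(i)} s_{i+1}) + (y_{i+1} y_{i+1}ᵀ)/(y_{i+1}ᵀ s_{i+1}) for i = 0, …, m−1 are all well defined, symmetric positive definite, and the final matrix B = B^{(m)} satisfies μ₁·I ⪯ B ⪯ μ₂·I; consequently its inverse H = B^{−1} satisfies (1/μ₂)·I ⪯ H ⪯ (1/μ₁)·I. -/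
open Matrix

/-- The (direct) BFGS update `B₊ = B − (B s sᵀ B)/(sᵀ B s) + (y yᵀ)/(yᵀ s)`. -/
noncomputable def bfgsUpdate {d : ℕ} (B : Matrix (Fin d) (Fin d) ℝ) (s y : Fin d → ℝ) :
    Matrix (Fin d) (Fin d) ℝ :=
  B - (s ⬝ᵥ B *ᵥ s)⁻¹ • (B * vecMulVec s s * B) + (y ⬝ᵥ s)⁻¹ • vecMulVec y y

/-- The inner L-BFGS loop: `B⁽⁰⁾ = (‖y_m‖²/(y_mᵀ s_m))·I` and
`B⁽ⁱ⁺¹⁾ = bfgsUpdate B⁽ⁱ⁾ s_{i+1} y_{i+1}`, with pairs indexed `1, …, m`. -/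
noncomputable def bfgsSeq {d : ℕ} (m : ℕ) (s y : ℕ → Fin d → ℝ) :
    ℕ → Matrix (Fin d) (Fin d) ℝ
  | 0 => ((y m ⬝ᵥ y m) / (y m ⬝ᵥ s m)) • 1
  | i + 1 => bfgsUpdate (bfgsSeq m s y i) (s (i + 1)) (y (i + 1))

/-- `B` is symmetric and `a ‖x‖² ≤ xᵀ B x ≤ b ‖x‖²` for every `x`. -/
def HasQuadBounds {d : ℕ} (B : Matrix (Fin d) (Fin d) ℝ) (a b : ℝ) : Prop :=
  B.IsHermitian ∧ ∀ x : Fin d → ℝ, a * (x ⬝ᵥ x) ≤ x ⬝ᵥ B *ᵥ x ∧ x ⬝ᵥ B *ᵥ x ≤ b * (x ⬝ᵥ x)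

theorem real_dotProduct_self_nonneg {d : ℕ} (x : Fin d → ℝ) : 0 ≤ x ⬝ᵥ x := by
  simpa using dotProduct_star_self_nonneg x

theorem real_dotProduct_self_pos {d : ℕ} {x : Fin d → ℝ} (hx : x ≠ 0) : 0 < x ⬝ᵥ x := by
  simpa using dotProduct_star_self_pos_iff.2 hx

theorem real_dotProduct_sq_le {d : ℕ} (x y : Fin d → ℝ) :
    (x ⬝ᵥ y) ^ 2 ≤ (x ⬝ᵥ x) * (y ⬝ᵥ y) := by
  simpa [dotProduct, sq] using Finset.sum_mul_sq_le_sq_mul_sq Finset.univ x y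

theorem Matrix.IsHermitian.dotProduct_mulVec_swap {d : ℕ} {B : Matrix (Fin d) (Fin d) ℝ}
    (hB : B.IsHermitian) (x y : Fin d → ℝ) : x ⬝ᵥ B *ᵥ y = y ⬝ᵥ B *ᵥ x := by
  have hT : Bᵀ = B := by simpa [IsHermitian, conjTranspose_eq_transpose_of_trivial] using hB
  rw [dotProduct_mulVec, dotProduct_comm, ← mulVec_transpose, hT]

theorem dotProduct_bfgsUpdate_mulVec {d : ℕ} {B : Matrix (Fin d) (Fin d) ℝ}
    (hB : B.IsHermitian) (s y x : Fin d → ℝ) :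
    x ⬝ᵥ bfgsUpdate B s y *ᵥ x =
      x ⬝ᵥ B *ᵥ x - (s ⬝ᵥ B *ᵥ x) ^ 2 / (s ⬝ᵥ B *ᵥ s) + (y ⬝ᵥ x) ^ 2 / (y ⬝ᵥ s) := by
  have h₁ : x ⬝ᵥ (B * vecMulVec s s * B) *ᵥ x = (s ⬝ᵥ B *ᵥ x) ^ 2 := by
    rw [← mulVec_mulVec, ← mulVec_mulVec, vecMulVec_mulVec, mulVec_smul, dotProduct_smul,
      hB.dotProduct_mulVec_swap x s]
    simp [sq]
  have h₂ : x ⬝ᵥ vecMulVec y y *ᵥ x = (y ⬝ᵥ x) ^ 2 := by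
    rw [vecMulVec_mulVec, dotProduct_smul, dotProduct_comm x y]
    simp [sq]
  rw [bfgsUpdate, add_mulVec, sub_mulVec, smul_mulVec, smul_mulVec, dotProduct_add,
    dotProduct_sub, dotProduct_smul, dotProduct_smul, h₁, h₂]
  simp only [smul_eq_mul]
  ring

theorem isHermitian_bfgsUpdate {d : ℕ} {B : Matrix (Fin d) (Fin d) ℝ}
    (hB : B.IsHermitian) (s y : Fin d → ℝ) : (bfgsUpdate B s y).IsHermitian := by
  have hT : Bᵀ = B := by simpa [IsHermitian, conjTranspose_eq_transpose_of_trivial] using hB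
  simp [IsHermitian, conjTranspose_eq_transpose_of_trivial, bfgsUpdate, transpose_vecMulVec, hT,
    Matrix.mul_assoc]

theorem HasQuadBounds.bfgsUpdate {d : ℕ} {B : Matrix (Fin d) (Fin d) ℝ} {a b ε L : ℝ}
    (ha : 0 < a) (hε : 0 < ε) (hL : 0 < L) (hB : HasQuadBounds B a b) {s y : Fin d → ℝ}
    (hs : s ≠ 0) (hys : ε * (s ⬝ᵥ s) ≤ y ⬝ᵥ s) (hy : y ⬝ᵥ y ≤ L * (s ⬝ᵥ s)) :
    HasQuadBounds (bfgsUpdate B s y)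
      (2 / a + 4 / ε + 4 * L / (ε ^ 2 * a))⁻¹ (b + L / ε) := by
  refine ⟨isHermitian_bfgsUpdate hB.1 s y, fun x => ?_⟩
  rw [dotProduct_bfgsUpdate_mulVec hB.1]
  have hS := real_dotProduct_self_pos hs
  have hσ : 0 < y ⬝ᵥ s := lt_of_lt_of_le (by positivity) hys
  have hK : 0 < s ⬝ᵥ B *ᵥ s := lt_of_lt_of_le (by positivity) (hB.2 s).1
  have hquot : ∀ z : Fin d → ℝ, (y ⬝ᵥ z) ^ 2 / (y ⬝ᵥ s) ≤ L / ε * (z ⬝ᵥ z) := by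
    intro z
    have hz := real_dotProduct_self_nonneg z
    rw [div_le_iff₀ hσ]
    calc (y ⬝ᵥ z) ^ 2 ≤ (y ⬝ᵥ y) * (z ⬝ᵥ z) := real_dotProduct_sq_le y z
      _ ≤ L * (s ⬝ᵥ s) * (z ⬝ᵥ z) := by gcongr
      _ = L / ε * (z ⬝ᵥ z) * (ε * (s ⬝ᵥ s)) := by field_simp
      _ ≤ L / ε * (z ⬝ᵥ z) * (y ⬝ᵥ s) := by gcongr
  constructor
  · obtain ⟨t, htK⟩ : ∃ t, s ⬝ᵥ B *ᵥ x = t * (s ⬝ᵥ B *ᵥ s) :=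
      ⟨(s ⬝ᵥ B *ᵥ x) / (s ⬝ᵥ B *ᵥ s), by field_simp⟩
    obtain ⟨z, rfl⟩ : ∃ z, x = z + t • s := ⟨x - t • s, by simp⟩
    have hw : s ⬝ᵥ B *ᵥ z = 0 := by
      simpa [mulVec_add, mulVec_smul] using htK
    have hmin : (z + t • s) ⬝ᵥ B *ᵥ (z + t • s) -
        (s ⬝ᵥ B *ᵥ (z + t • s)) ^ 2 / (s ⬝ᵥ B *ᵥ s) = z ⬝ᵥ B *ᵥ z := by
      rw [htK]
      simp only [mulVec_add, mulVec_smul, dotProduct_add, add_dotProduct, dotProduct_smul,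
        smul_dotProduct, smul_eq_mul, hB.1.dotProduct_mulVec_swap z s, hw]
      field_simp
      ring
    rw [hmin]
    set P := (y ⬝ᵥ (z + t • s)) ^ 2 / (y ⬝ᵥ s) with hP
    have hP0 : 0 ≤ P := by positivity
    have hZ := real_dotProduct_self_nonneg z
    have hpar : (z + t • s) ⬝ᵥ (z + t • s) ≤ 2 * (z ⬝ᵥ z) + 2 * (t ^ 2 * (s ⬝ᵥ s)) := by
      have h := real_dotProduct_self_nonneg (z - t • s)
      simp only [dotProduct_add, add_dotProduct, dotProduct_sub, sub_dotProduct, dotProduct_smul,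
        smul_dotProduct, smul_eq_mul] at h ⊢
      nlinarith
    have htσ : t ^ 2 * (y ⬝ᵥ s) ≤ 2 * P + 2 * ((y ⬝ᵥ z) ^ 2 / (y ⬝ᵥ s)) := by
      rw [hP, ← mul_div_assoc, ← mul_div_assoc, ← add_div, le_div_iff₀ hσ]
      simp only [dotProduct_add, dotProduct_smul, smul_eq_mul]
      nlinarith [sq_nonneg (2 * (y ⬝ᵥ z) + t * (y ⬝ᵥ s))]
    have htS : t ^ 2 * (s ⬝ᵥ s) ≤ (2 * P + 2 * (L / ε * (z ⬝ᵥ z))) / ε := by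
      rw [le_div_iff₀ hε]
      nlinarith [hquot z, mul_le_mul_of_nonneg_left hys (sq_nonneg t)]
    have hzB : z ⬝ᵥ z ≤ (z ⬝ᵥ B *ᵥ z) / a := by
      rw [le_div_iff₀ ha]
      linarith [(hB.2 z).1]
    have hq : 0 ≤ z ⬝ᵥ B *ᵥ z := le_trans (by positivity) (hB.2 z).1
    rw [inv_mul_le_iff₀ (by positivity)]
    calc (z + t • s) ⬝ᵥ (z + t • s)
        ≤ 2 * (z ⬝ᵥ z) + 2 * ((2 * P + 2 * (L / ε * (z ⬝ᵥ z))) / ε) := by linarith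
      _ = (2 + 4 * L / ε ^ 2) * (z ⬝ᵥ z) + 4 / ε * P := by field_simp; ring
      _ ≤ (2 + 4 * L / ε ^ 2) * ((z ⬝ᵥ B *ᵥ z) / a) + 4 / ε * P := by gcongr
      _ = (2 / a + 4 * L / (ε ^ 2 * a)) * (z ⬝ᵥ B *ᵥ z) + 4 / ε * P := by field_simp
      _ ≤ (2 / a + 4 * L / (ε ^ 2 * a)) * (z ⬝ᵥ B *ᵥ z) + 4 / ε * P +
          (4 / ε * (z ⬝ᵥ B *ᵥ z) + (2 / a + 4 * L / (ε ^ 2 * a)) * P) :=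
        le_add_of_nonneg_right (by positivity)
      _ = (2 / a + 4 / ε + 4 * L / (ε ^ 2 * a)) * (z ⬝ᵥ B *ᵥ z + P) := by ring
  · have : 0 ≤ (s ⬝ᵥ B *ᵥ x) ^ 2 / (s ⬝ᵥ B *ᵥ s) := by positivity
    linarith [(hB.2 x).2, hquot x]

theorem hasQuadBounds_scaled_one {d : ℕ} {ε L : ℝ} (hε : 0 < ε) (hL : 0 < L) {s y : Fin d → ℝ}
    (hs : s ≠ 0) (hys : ε * (s ⬝ᵥ s) ≤ y ⬝ᵥ s) (hy : y ⬝ᵥ y ≤ L * (s ⬝ᵥ s)) :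
    HasQuadBounds (((y ⬝ᵥ y) / (y ⬝ᵥ s)) • (1 : Matrix (Fin d) (Fin d) ℝ)) ε (L / ε) := by
  have hS := real_dotProduct_self_pos hs
  have hσ : 0 < y ⬝ᵥ s := lt_of_lt_of_le (by positivity) hys
  refine ⟨by simp [IsHermitian], fun x => ?_⟩
  have hx := real_dotProduct_self_nonneg x
  rw [smul_mulVec, one_mulVec, dotProduct_smul, smul_eq_mul]
  constructor
  · refine mul_le_mul_of_nonneg_right ?_ hx
    rw [le_div_iff₀ hσ]
    refine le_of_mul_le_mul_right ?_ hS
    nlinarith [real_dotProduct_sq_le y s, mul_le_mul_of_nonneg_right hys hσ.le]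
  · refine mul_le_mul_of_nonneg_right ?_ hx
    rw [div_le_iff₀ hσ]
    calc y ⬝ᵥ y ≤ L * (s ⬝ᵥ s) := hy
      _ = L / ε * (ε * (s ⬝ᵥ s)) := by field_simp
      _ ≤ L / ε * (y ⬝ᵥ s) := by gcongr

theorem exists_hasQuadBounds_bfgsSeq {d m : ℕ} (hm : 1 ≤ m) {ε L : ℝ} (hε : 0 < ε) (hL : 0 < L)
    (i : ℕ) (hi : i ≤ m) :
    ∃ a b : ℝ, 0 < a ∧ ∀ s y : ℕ → Fin d → ℝ,
      (∀ j, 1 ≤ j → j ≤ m →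
        s j ≠ 0 ∧ ε * (s j ⬝ᵥ s j) ≤ y j ⬝ᵥ s j ∧ y j ⬝ᵥ y j ≤ L * (s j ⬝ᵥ s j)) →
      HasQuadBounds (bfgsSeq m s y i) a b := by
  induction i with
  | zero =>
    refine ⟨ε, L / ε, hε, fun s y h => ?_⟩
    obtain ⟨hs, hys, hy⟩ := h m hm le_rfl
    exact hasQuadBounds_scaled_one hε hL hs hys hy
  | succ i ih =>
    obtain ⟨a, b, ha, hB⟩ := ih (by omega)
    refine ⟨(2 / a + 4 / ε + 4 * L / (ε ^ 2 * a))⁻¹, b + L / ε, by positivity,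
      fun s y h => ?_⟩
    obtain ⟨hs, hys, hy⟩ := h (i + 1) (by omega) hi
    exact (hB s y h).bfgsUpdate ha hε hL hs hys hy

namespace HasQuadBounds

variable {d : ℕ} {B : Matrix (Fin d) (Fin d) ℝ} {a b : ℝ}

theorem mono_right {c : ℝ} (hB : HasQuadBounds B a b) (hbc : b ≤ c) : HasQuadBounds B a c :=
  ⟨hB.1, fun x => ⟨(hB.2 x).1, (hB.2 x).2.trans
    (mul_le_mul_of_nonneg_right hbc (real_dotProduct_self_nonneg x))⟩⟩

theorem posDef (hB : HasQuadBounds B a b) (ha : 0 < a) : B.PosDef :=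
  .of_dotProduct_mulVec_pos hB.1 fun x hx => by
    simpa using lt_of_lt_of_le (mul_pos ha (real_dotProduct_self_pos hx)) (hB.2 x).1

theorem posSemidef_sub_smul_one (hB : HasQuadBounds B a b) : (B - a • 1).PosSemidef :=
  .of_dotProduct_mulVec_nonneg (hB.1.sub (by simp [IsHermitian])) fun x => by
    simpa [sub_mulVec, smul_mulVec] using (hB.2 x).1

theorem posSemidef_smul_one_sub (hB : HasQuadBounds B a b) : (b • 1 - B).PosSemidef :=
  .of_dotProduct_mulVec_nonneg (.sub (by simp [IsHermitian]) hB.1) fun x => by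
    simpa [sub_mulVec, smul_mulVec] using (hB.2 x).2

protected theorem inv (hB : HasQuadBounds B a b) (ha : 0 < a) (hb : 0 < b) :
    HasQuadBounds B⁻¹ b⁻¹ a⁻¹ := by
  have hdet : IsUnit B.det := (hB.posDef ha).det_pos.ne'.isUnit
  refine ⟨hB.1.inv, fun x => ?_⟩
  obtain ⟨u, rfl⟩ : ∃ u, x = B *ᵥ u :=
    ⟨B⁻¹ *ᵥ x, by rw [mulVec_mulVec, mul_nonsing_inv _ hdet, one_mulVec]⟩
  rw [mulVec_mulVec, nonsing_inv_mul _ hdet, one_mulVec, dotProduct_comm _ u]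
  set x := B *ᵥ u with hx
  constructor
  · rw [inv_mul_le_iff₀ hb]
    have hux : u ⬝ᵥ B *ᵥ x = x ⬝ᵥ x := by rw [hB.1.dotProduct_mulVec_swap, ← hx]
    have hpos : 0 ≤ (b • u - x) ⬝ᵥ B *ᵥ (b • u - x) :=
      le_trans (mul_nonneg ha.le (real_dotProduct_self_nonneg _)) (hB.2 _).1
    simp only [mulVec_sub, mulVec_smul, dotProduct_sub, sub_dotProduct, dotProduct_smul,
      smul_dotProduct, smul_eq_mul, hux, ← hx] at hpos
    refine le_of_mul_le_mul_left ?_ hb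
    nlinarith [(hB.2 x).2]
  · rw [le_inv_mul_iff₀ ha]
    have hpos := real_dotProduct_self_nonneg (x - a • u)
    simp only [dotProduct_sub, sub_dotProduct, dotProduct_smul, smul_dotProduct, smul_eq_mul,
      dotProduct_comm x u] at hpos
    nlinarith [mul_le_mul_of_nonneg_left (hB.2 u).1 ha.le]

end HasQuadBounds

/-- Lemma 3.3, nonconvex case: there are constants `0 < μ₁ ≤ μ₂` depending
only on `d, m, ε, Λ_O` such that for any curvature pairs `(s_j, y_j)`, `j = 1, …, m`,
with `s_j ≠ 0`, `y_jᵀs_j ≥ ε‖s_j‖²` and `‖y_j‖ ≤ Λ_O‖s_j‖`, all the matrices of the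
inner L-BFGS loop are symmetric positive definite, and the final matrix `B = B⁽ᵐ⁾`
satisfies `μ₁·I ⪯ B ⪯ μ₂·I`; consequently `H = B⁻¹` satisfies
`(1/μ₂)·I ⪯ H ⪯ (1/μ₁)·I`. -/
theorem stmt_8 (d m : ℕ) (hd : 1 ≤ d) (hm : 1 ≤ m)
    (ε ΛO : ℝ) (hε : 0 < ε) (hΛ : 0 < ΛO) :
    ∃ μ₁ μ₂ : ℝ, 0 < μ₁ ∧ μ₁ ≤ μ₂ ∧
      ∀ s y : ℕ → Fin d → ℝ,
        (∀ j, 1 ≤ j → j ≤ m →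
          s j ≠ 0 ∧ ε * (s j ⬝ᵥ s j) ≤ y j ⬝ᵥ s j ∧
            Real.sqrt (y j ⬝ᵥ y j) ≤ ΛO * Real.sqrt (s j ⬝ᵥ s j)) →
        (∀ i, i ≤ m → (bfgsSeq m s y i).PosDef) ∧
          (bfgsSeq m s y m - μ₁ • 1).PosSemidef ∧
          ((μ₂ • 1 : Matrix (Fin d) (Fin d) ℝ) - bfgsSeq m s y m).PosSemidef ∧
          ((bfgsSeq m s y m)⁻¹ - μ₂⁻¹ • 1).PosSemidef ∧
          ((μ₁⁻¹ • 1 : Matrix (Fin d) (Fin d) ℝ) - (bfgsSeq m s y m)⁻¹).PosSemidef := by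
  have hsq : ∀ s y : Fin d → ℝ, √(y ⬝ᵥ y) ≤ ΛO * √(s ⬝ᵥ s) → y ⬝ᵥ y ≤ ΛO ^ 2 * (s ⬝ᵥ s) := by
    intro s y h
    have h' := pow_le_pow_left₀ (Real.sqrt_nonneg _) h 2
    rwa [mul_pow, Real.sq_sqrt (real_dotProduct_self_nonneg y),
      Real.sq_sqrt (real_dotProduct_self_nonneg s)] at h'
  have hL : 0 < ΛO ^ 2 := by positivity
  obtain ⟨a, b, ha, hB⟩ := exists_hasQuadBounds_bfgsSeq (d := d) hm hε hL m le_rfl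
  refine ⟨a, max a b, ha, le_max_left a b, fun s y h => ?_⟩
  have h' : ∀ j, 1 ≤ j → j ≤ m →
      s j ≠ 0 ∧ ε * (s j ⬝ᵥ s j) ≤ y j ⬝ᵥ s j ∧ y j ⬝ᵥ y j ≤ ΛO ^ 2 * (s j ⬝ᵥ s j) :=
    fun j h₁ h₂ => ⟨(h j h₁ h₂).1, (h j h₁ h₂).2.1, hsq _ _ (h j h₁ h₂).2.2⟩
  have hBm := (hB s y h').mono_right (le_max_right a b)
  have hinv := hBm.inv ha (lt_max_of_lt_left ha)
  refine ⟨fun i hi => ?_, hBm.posSemidef_sub_smul_one, hBm.posSemidef_smul_one_sub,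
    hinv.posSemidef_sub_smul_one, hinv.posSemidef_smul_one_sub⟩
  obtain ⟨a', b', ha', hB'⟩ := exists_hasQuadBounds_bfgsSeq (d := d) hm hε hL i hi
  exact (hB' s y h').posDef ha'
end

section
/- (Theorem 3.2, strongly convex case.) Let F : ℝ^d → ℝ be twice continuously differentiable with λ·I ⪯ ∇²F(w) ⪯ Λ·I for all w, where 0 < λ ≤ Λ, let w* be its minimizer and F* = F(w*). Let (Ω, 𝓕, ℙ) be a probability space with a filtration (𝓕_k)_{k≥0}, let 0 < μ₁ ≤ μ₂, γ ≥ 0, and let the step length satisfy α ∈ (0, 1/(2μ₁λ)). Let w₀ ∈ ℝ^d be deterministic and define recursively w_{k+1} = w_k − α H_k g_k, where: H_k is an 𝓕_k-measurable random symmetric d×d matrix with μ₁·I ⪯ H_k ⪯ μ₂·I almost surely; g_k is an 𝓕_{k+1}-measurable ℝ^d-valued random vector with E[g_k | 𝓕_k] = ∇F(w_k) and E[‖g_k‖² | 𝓕_k] ≤ γ² almost surely. Then for all k ≥ 0, E[F(w_k)] − F* − N ≤ (1 − 2αμ₁λ)^k · (F(w₀) − F* − N), where N = α μ₂² γ² Λ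 / (4 μ₁ λ); in particular E[F(w_k)] − F* ≤ (1 − 2αμ₁λ)^k (F(w₀) − F*) + N. -/
open Matrix MeasureTheory
open scoped RealInnerProductSpace

/-- Second-order Taylor lower bound on `[0, 1]` for a function whose second derivative is at
least `c`. -/
lemma taylor_lower_bound_of_le_second_deriv {f f' f'' : ℝ → ℝ} {c : ℝ}
    (hf : ∀ t, HasDerivAt f (f' t) t) (hf' : ∀ t, HasDerivAt f' (f'' t) t)
    (hc : ∀ t, c ≤ f'' t) : f 0 + f' 0 + c / 2 ≤ f 1 := by
  have h1 : ∀ t, HasDerivAt (fun t => f' t - c * t) (f'' t - c) t := fun t =>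
    ((hf' t).sub ((hasDerivAt_id t).const_mul c)).congr_deriv (by simp)
  have hmono : Monotone fun t => f' t - c * t :=
    monotone_of_deriv_nonneg (fun t => (h1 t).differentiableAt) fun t => by
      rw [(h1 t).deriv]; linarith [hc t]
  have h2 : ∀ t, HasDerivAt (fun t => f t - f' 0 * t - c / 2 * t ^ 2) (f' t - f' 0 - c * t) t :=
    fun t => by
      refine (((hf t).sub ((hasDerivAt_id t).const_mul (f' 0))).sub
        ((hasDerivAt_pow 2 t).const_mul (c / 2))).congr_deriv ?_
      norm_num
      ring
  have hmono2 : MonotoneOn (fun t => f t - f' 0 * t - c / 2 * t ^ 2) (Set.Icc 0 1) := by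
    refine monotoneOn_of_hasDerivWithinAt_nonneg (convex_Icc 0 1)
      (fun t _ => (h2 t).continuousAt.continuousWithinAt)
      (fun t _ => (h2 t).hasDerivWithinAt) fun t ht => ?_
    rw [interior_Icc] at ht
    have := hmono ht.1.le
    simp only [mul_zero, sub_zero] at this
    linarith
  have := hmono2 (Set.left_mem_Icc.2 zero_le_one) (Set.right_mem_Icc.2 zero_le_one) zero_le_one
  norm_num at this
  linarith

section Hilbert

variable {E : Type*} [NormedAddCommGroup E] [InnerProductSpace ℝ E] [CompleteSpace E]

lemma ContDiff.differentiable_gradient {F : E → ℝ} (hF : ContDiff ℝ 2 F) :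
    Differentiable ℝ (gradient F) := by
  have h : Differentiable ℝ (fderiv ℝ F) :=
    (hF.fderiv_right (m := 1) (by norm_num)).differentiable (by norm_num)
  exact (InnerProductSpace.toDual ℝ E).symm.toContinuousLinearEquiv.differentiable.comp h

lemma hasDerivAt_comp_line {F : E → ℝ} (hF : Differentiable ℝ F) (x v : E) (t : ℝ) :
    HasDerivAt (fun t : ℝ => F (x + t • v)) ⟪gradient F (x + t • v), v⟫ t := by
  have hl : HasDerivAt (fun t : ℝ => x + t • v) v t := by
    simpa using ((hasDerivAt_id t).smul_const v).const_add x
  have := (hF (x + t • v)).hasGradientAt.hasFDerivAt.comp_hasDerivAt t hl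
  exact this.congr_deriv (by simp)

lemma hasDerivAt_inner_gradient_line {F : E → ℝ} (hF : ContDiff ℝ 2 F) (x v : E) (t : ℝ) :
    HasDerivAt (fun t : ℝ => ⟪gradient F (x + t • v), v⟫)
      ⟪v, fderiv ℝ (gradient F) (x + t • v) v⟫ t := by
  have hl : HasDerivAt (fun t : ℝ => x + t • v) v t := by
    simpa using ((hasDerivAt_id t).smul_const v).const_add x
  have h := (hF.differentiable_gradient (x + t • v)).hasFDerivAt.comp_hasDerivAt t hl
  have := h.inner ℝ (hasDerivAt_const t v)
  refine this.congr_deriv ?_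
  simp [real_inner_comm]

/-- Quadratic lower bound for a `C²` function with Hessian bounded below by `c`. -/
lemma quadratic_lower_bound_of_hessian {F : E → ℝ} (hF : ContDiff ℝ 2 F) {c : ℝ}
    (hc : ∀ u v : E, c * ‖v‖ ^ 2 ≤ ⟪v, fderiv ℝ (gradient F) u v⟫) (x v : E) :
    F x + ⟪gradient F x, v⟫ + c / 2 * ‖v‖ ^ 2 ≤ F (x + v) := by
  have := taylor_lower_bound_of_le_second_deriv
    (hasDerivAt_comp_line (hF.differentiable (by norm_num)) x v)
    (hasDerivAt_inner_gradient_line hF x v) (fun t => hc (x + t • v) v)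
  simp only [zero_smul, add_zero, one_smul] at this
  linarith

/-- Quadratic upper bound (descent lemma) for a `C²` function with Hessian bounded above by `C`. -/
lemma quadratic_upper_bound_of_hessian {F : E → ℝ} (hF : ContDiff ℝ 2 F) {C : ℝ}
    (hC : ∀ u v : E, ⟪v, fderiv ℝ (gradient F) u v⟫ ≤ C * ‖v‖ ^ 2) (x v : E) :
    F (x + v) ≤ F x + ⟪gradient F x, v⟫ + C / 2 * ‖v‖ ^ 2 := by
  have := taylor_lower_bound_of_le_second_deriv (c := -(C * ‖v‖ ^ 2))
    (fun t => (hasDerivAt_comp_line (hF.differentiable (by norm_num)) x v t).neg)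
    (fun t => (hasDerivAt_inner_gradient_line hF x v t).neg)
    (fun t => neg_le_neg (hC (x + t • v) v))
  simp only [Pi.neg_apply, zero_smul, add_zero, one_smul] at this
  linarith

/-- Polyak–Łojasiewicz inequality for a `C²` function with Hessian bounded below by `c > 0`. -/
lemma polyak_lojasiewicz_of_hessian {F : E → ℝ} (hF : ContDiff ℝ 2 F) {c : ℝ} (hc0 : 0 < c)
    (hc : ∀ u v : E, c * ‖v‖ ^ 2 ≤ ⟪v, fderiv ℝ (gradient F) u v⟫) (x y : E) :
    2 * c * (F x - F y) ≤ ‖gradient F x‖ ^ 2 := by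
  have h := quadratic_lower_bound_of_hessian hF hc x (y - x)
  rw [add_sub_cancel] at h
  have h2 := neg_le_of_abs_le (abs_real_inner_le_norm (gradient F x) (y - x))
  nlinarith [sq_nonneg (‖gradient F x‖ - c * ‖y - x‖)]

end Hilbert

section Matrix

variable {d : ℕ} {A : Matrix (Fin d) (Fin d) ℝ}

lemma mul_norm_sq_le_inner_toEuclideanLin {a : ℝ} (hA : (A - a • 1).PosSemidef)
    (v : EuclideanSpace ℝ (Fin d)) : a * ‖v‖ ^ 2 ≤ ⟪toEuclideanLin A v, v⟫ := by
  have := (isPositive_toEuclideanLin_iff.2 hA).re_inner_nonneg_left v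
  simp [inner_sub_left, inner_smul_left] at this
  linarith

lemma inner_toEuclideanLin_le_mul_norm_sq {b : ℝ}
    (hA : ((b • 1 : Matrix (Fin d) (Fin d) ℝ) - A).PosSemidef)
    (v : EuclideanSpace ℝ (Fin d)) : ⟪toEuclideanLin A v, v⟫ ≤ b * ‖v‖ ^ 2 := by
  have := (isPositive_toEuclideanLin_iff.2 hA).re_inner_nonneg_left v
  simp [inner_sub_left, inner_smul_left] at this
  linarith

lemma inner_toEuclideanLin_comm (hA : A.IsSymm) (u v : EuclideanSpace ℝ (Fin d)) :
    ⟪toEuclideanLin A u, v⟫ = ⟪u, toEuclideanLin A v⟫ :=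
  isSymmetric_toEuclideanLin_iff.2 (by simpa [IsHermitian] using hA.eq) u v

lemma norm_toEuclideanLin_le {a b : ℝ} (ha : 0 < a) (hab : a ≤ b) (hsymm : A.IsSymm)
    (h1 : (A - a • 1).PosSemidef) (h2 : ((b • 1 : Matrix (Fin d) (Fin d) ℝ) - A).PosSemidef)
    (v : EuclideanSpace ℝ (Fin d)) : ‖toEuclideanLin A v‖ ^ 2 ≤ b ^ 2 * ‖v‖ ^ 2 := by
  have hb : 0 < b := ha.trans_le hab
  set Av := toEuclideanLin A v with hAv
  have e1 := mul_norm_sq_le_inner_toEuclideanLin h1 (b • v - Av)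
  have e2 := inner_toEuclideanLin_le_mul_norm_sq h2 v
  have e3 := inner_toEuclideanLin_le_mul_norm_sq h2 Av
  have e4 : ⟪toEuclideanLin A Av, v⟫ = ‖Av‖ ^ 2 := by
    rw [inner_toEuclideanLin_comm hsymm, ← hAv, real_inner_self_eq_norm_sq]
  have e5 : 0 ≤ ⟪toEuclideanLin A (b • v - Av), b • v - Av⟫ := le_trans (by positivity) e1
  rw [map_sub, map_smul, ← hAv] at e5
  simp only [inner_sub_left, inner_sub_right, real_inner_smul_left, real_inner_smul_right, e4,
    real_inner_self_eq_norm_sq] at e5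
  rw [← hAv] at e2
  have e6 : b * ‖Av‖ ^ 2 ≤ b * (b ^ 2 * ‖v‖ ^ 2) := by nlinarith
  exact le_of_mul_le_mul_left e6 hb

lemma measurable_toEuclideanLin {Ω : Type*} {m : MeasurableSpace Ω}
    {H : Ω → Matrix (Fin d) (Fin d) ℝ} {v : Ω → EuclideanSpace ℝ (Fin d)}
    (hH : ∀ i j, Measurable fun ω => H ω i j) (hv : Measurable v) :
    Measurable fun ω => toEuclideanLin (H ω) (v ω) := by
  refine (MeasurableEquiv.toLp 2 (Fin d → ℝ)).measurable.comp
    (g := fun y => WithLp.toLp 2 y) (f := fun ω => H ω *ᵥ (v ω).ofLp) ?_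
  refine measurable_pi_iff.2 fun i => ?_
  simp only [mulVec, dotProduct]
  refine Finset.measurable_sum _ fun j _ => (hH i j).mul ?_
  fun_prop

end Matrix

section CondExp

variable {Ω E : Type*} {m m0 : MeasurableSpace Ω} {μ : Measure Ω}
  [NormedAddCommGroup E] [InnerProductSpace ℝ E]

lemma integrable_inner_of_integrable_norm_sq {f g : Ω → E} (hf : AEStronglyMeasurable f μ)
    (hg : AEStronglyMeasurable g μ) (hf2 : Integrable (fun ω => ‖f ω‖ ^ 2) μ)
    (hg2 : Integrable (fun ω => ‖g ω‖ ^ 2) μ) : Integrable (fun ω => ⟪f ω, g ω⟫) μ := by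
  refine (hf2.add hg2).mono (hf.inner hg) (Filter.Eventually.of_forall fun ω => ?_)
  have h := norm_inner_le_norm (𝕜 := ℝ) (f ω) (g ω)
  rw [Pi.add_apply, Real.norm_of_nonneg (by positivity : 0 ≤ ‖f ω‖ ^ 2 + ‖g ω‖ ^ 2)]
  nlinarith [sq_nonneg (‖f ω‖ - ‖g ω‖), sq_nonneg (‖f ω‖), sq_nonneg (‖g ω‖)]

lemma integral_inner_condExp [CompleteSpace E] [IsFiniteMeasure μ] (hm : m ≤ m0) {f g : Ω → E}
    (hf : StronglyMeasurable[m] f) (hg : Integrable g μ)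
    (hfg : Integrable (fun ω => ⟪f ω, g ω⟫) μ) :
    ∫ ω, ⟪f ω, g ω⟫ ∂μ = ∫ ω, ⟪f ω, (μ[g | m]) ω⟫ ∂μ := by
  rw [← integral_condExp hm (f := fun ω => ⟪f ω, g ω⟫)]
  exact integral_congr_ae (condExp_bilin_of_stronglyMeasurable_left (innerSL ℝ) hf hfg hg)

end CondExp

/-- One-step descent for a preconditioned gradient step with direction `A g`. -/
lemma preconditioned_step_le {d : ℕ} {F : EuclideanSpace ℝ (Fin d) → ℝ} (hF : ContDiff ℝ 2 F)
    {C : ℝ} (hC0 : 0 ≤ C)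
    (hC : ∀ u v : EuclideanSpace ℝ (Fin d), ⟪v, fderiv ℝ (gradient F) u v⟫ ≤ C * ‖v‖ ^ 2)
    {A : Matrix (Fin d) (Fin d) ℝ} {a b : ℝ} (ha : 0 < a) (hab : a ≤ b) (hsymm : A.IsSymm)
    (h1 : (A - a • 1).PosSemidef) (h2 : ((b • 1 : Matrix (Fin d) (Fin d) ℝ) - A).PosSemidef)
    (α : ℝ) (x v : EuclideanSpace ℝ (Fin d)) :
    F (x - α • toEuclideanLin A v) ≤
      F x - α * ⟪toEuclideanLin A (gradient F x), v⟫ + C / 2 * α ^ 2 * b ^ 2 * ‖v‖ ^ 2 := by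
  have h := quadratic_upper_bound_of_hessian hF hC x (-(α • toEuclideanLin A v))
  rw [← sub_eq_add_neg, inner_neg_right, real_inner_smul_right,
    ← inner_toEuclideanLin_comm hsymm, norm_neg, norm_smul, mul_pow, Real.norm_eq_abs,
    sq_abs] at h
  have hn := mul_le_mul_of_nonneg_left (norm_toEuclideanLin_le ha hab hsymm h1 h2 v)
    (by positivity : 0 ≤ C / 2 * α ^ 2)
  linarith

lemma integral_le_of_condExp_le {Ω : Type*} {m m0 : MeasurableSpace Ω} {μ : Measure Ω}
    [IsProbabilityMeasure μ] (hm : m ≤ m0) {f : Ω → ℝ} {c : ℝ}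
    (h : ∀ᵐ ω ∂μ, (μ[f | m]) ω ≤ c) : ∫ ω, f ω ∂μ ≤ c := by
  rw [← integral_condExp hm]
  simpa using integral_mono_ae integrable_condExp (integrable_const c) h

/-- A contraction `u (k + 1) ≤ (1 - q) * u k + q * N` towards `N` decreases geometrically. -/
lemma sub_le_pow_mul_sub_of_contraction {u : ℕ → ℝ} {q N : ℝ} (hq : q ≤ 1)
    (h : ∀ k, u (k + 1) ≤ (1 - q) * u k + q * N) (k : ℕ) :
    u k - N ≤ (1 - q) ^ k * (u 0 - N) := by
  induction k with
  | zero => simp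
  | succ k ih =>
    have := mul_le_mul_of_nonneg_left ih (sub_nonneg.2 hq)
    rw [pow_succ']
    linarith [h k]

/-- Theorem 3.2, strongly convex case: linear convergence to a neighborhood
of the optimum for the multi-batch L-BFGS iteration `w_{k+1} = w_k − α H_k g_k` with fixed
step length `α ∈ (0, 1/(2μ₁λ))`, eigenvalue bounds `μ₁·I ⪯ H_k ⪯ μ₂·I` a.s., unbiased
stochastic gradients `E[g_k | 𝓕_k] = ∇F(w_k)` with second moment `E[‖g_k‖² | 𝓕_k] ≤ γ²`. -/
theorem stmt_13 {d : ℕ} {Ω : Type*} {m0 : MeasurableSpace Ω} (μ : Measure Ω)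
    [IsProbabilityMeasure μ] (𝓕 : Filtration ℕ m0)
    (F : EuclideanSpace ℝ (Fin d) → ℝ) (lam Lam : ℝ)
    (hlam : 0 < lam) (hlamLam : lam ≤ Lam) (hF : ContDiff ℝ 2 F)
    (hHess : ∀ u v : EuclideanSpace ℝ (Fin d),
      lam * ‖v‖ ^ 2 ≤ ⟪v, fderiv ℝ (gradient F) u v⟫ ∧
        ⟪v, fderiv ℝ (gradient F) u v⟫ ≤ Lam * ‖v‖ ^ 2)
    (wstar : EuclideanSpace ℝ (Fin d)) (hmin : ∀ x, F wstar ≤ F x)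
    (μ₁ μ₂ γ α : ℝ) (hμ₁ : 0 < μ₁) (hμ₁₂ : μ₁ ≤ μ₂) (hγ : 0 ≤ γ)
    (hα : 0 < α) (hα2 : α < 1 / (2 * μ₁ * lam))
    (w0 : EuclideanSpace ℝ (Fin d))
    (H : ℕ → Ω → Matrix (Fin d) (Fin d) ℝ)
    (g : ℕ → Ω → EuclideanSpace ℝ (Fin d))
    (w : ℕ → Ω → EuclideanSpace ℝ (Fin d))
    (hw0 : ∀ ω, w 0 ω = w0)
    (hwrec : ∀ k ω, w (k + 1) ω = w k ω - α • Matrix.toEuclideanLin (H k ω) (g k ω))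
    (hHmeas : ∀ k i j, Measurable[𝓕 k] fun ω => H k ω i j)
    (hHsymm : ∀ k, ∀ᵐ ω ∂μ, (H k ω).IsSymm)
    (hHbound : ∀ k, ∀ᵐ ω ∂μ, (H k ω - μ₁ • 1).PosSemidef ∧
      ((μ₂ • 1 : Matrix (Fin d) (Fin d) ℝ) - H k ω).PosSemidef)
    (hgmeas : ∀ k, Measurable[𝓕 (k + 1)] (g k))
    (hgint : ∀ k, Integrable (g k) μ)
    (hg2int : ∀ k, Integrable (fun ω => ‖g k ω‖ ^ 2) μ)
    (hgcond : ∀ k, μ[g k | 𝓕 k] =ᵐ[μ] fun ω => gradient F (w k ω))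
    (hg2cond : ∀ k, ∀ᵐ ω ∂μ, (μ[fun ω' => ‖g k ω'‖ ^ 2 | 𝓕 k]) ω ≤ γ ^ 2)
    (hFint : ∀ k, Integrable (fun ω => F (w k ω)) μ)
    (hgradint : ∀ k, Integrable (fun ω => ‖gradient F (w k ω)‖ ^ 2) μ) :
    ∀ k, (∫ ω, F (w k ω) ∂μ) - F wstar - α * μ₂ ^ 2 * γ ^ 2 * Lam / (4 * μ₁ * lam) ≤
        (1 - 2 * α * μ₁ * lam) ^ k *
          (F w0 - F wstar - α * μ₂ ^ 2 * γ ^ 2 * Lam / (4 * μ₁ * lam)) ∧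
      (∫ ω, F (w k ω) ∂μ) - F wstar ≤
        (1 - 2 * α * μ₁ * lam) ^ k * (F w0 - F wstar) +
          α * μ₂ ^ 2 * γ ^ 2 * Lam / (4 * μ₁ * lam) := by
  have hLam : 0 < Lam := hlam.trans_le hlamLam
  have hq : 2 * α * μ₁ * lam ≤ 1 := by
    rw [lt_div_iff₀ (by positivity)] at hα2
    linarith
  have hgrad : Measurable (gradient F) := hF.differentiable_gradient.continuous.measurable
  have hwmeas : ∀ k, Measurable[𝓕 k] (w k) := by
    intro k
    induction k with
    | zero =>
      rw [funext hw0]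
      exact measurable_const
    | succ k ih =>
      rw [funext (hwrec k)]
      have hle := 𝓕.mono (Nat.le_succ k)
      exact (ih.mono hle le_rfl).sub ((measurable_toEuclideanLin
        (fun i j => (hHmeas k i j).mono hle le_rfl) (hgmeas k)).const_smul α)
  have hstep : ∀ k, (∫ ω, F (w (k + 1) ω) ∂μ) - F wstar ≤
      (1 - 2 * α * μ₁ * lam) * ((∫ ω, F (w k ω) ∂μ) - F wstar) +
        2 * α * μ₁ * lam * (α * μ₂ ^ 2 * γ ^ 2 * Lam / (4 * μ₁ * lam)) := by
    intro k
    have hG : Measurable[𝓕 k] fun ω => gradient F (w k ω) := hgrad.comp (hwmeas k)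
    have hD : Measurable[𝓕 k] fun ω => toEuclideanLin (H k ω) (gradient F (w k ω)) :=
      measurable_toEuclideanLin (hHmeas k) hG
    have hG' := (hG.mono (𝓕.le k) le_rfl).aestronglyMeasurable (μ := μ)
    have hD' := (hD.mono (𝓕.le k) le_rfl).aestronglyMeasurable (μ := μ)
    have hD2 : Integrable
        (fun ω => ‖toEuclideanLin (H k ω) (gradient F (w k ω))‖ ^ 2) μ := by
      refine ((hgradint k).const_mul (μ₂ ^ 2)).mono (hD'.norm.pow 2) ?_
      filter_upwards [hHsymm k, hHbound k] with ω hs hb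
      rw [Real.norm_of_nonneg (by positivity), Real.norm_of_nonneg (by positivity)]
      exact norm_toEuclideanLin_le hμ₁ hμ₁₂ hs hb.1 hb.2 _
    have hDg := integrable_inner_of_integrable_norm_sq hD' (hgint k).aestronglyMeasurable hD2
      (hg2int k)
    have hDG := integrable_inner_of_integrable_norm_sq hD' hG' hD2 (hgradint k)
    have hcross : 2 * μ₁ * lam * ((∫ ω, F (w k ω) ∂μ) - F wstar) ≤
        ∫ ω, ⟪toEuclideanLin (H k ω) (gradient F (w k ω)), g k ω⟫ ∂μ := by
      rw [integral_inner_condExp (𝓕.le k) hD.stronglyMeasurable (hgint k) hDg]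
      calc 2 * μ₁ * lam * ((∫ ω, F (w k ω) ∂μ) - F wstar)
          = ∫ ω, 2 * μ₁ * lam * (F (w k ω) - F wstar) ∂μ := by
            rw [integral_const_mul, integral_sub (hFint k) (integrable_const _)]
            simp
        _ ≤ ∫ ω, ⟪toEuclideanLin (H k ω) (gradient F (w k ω)), gradient F (w k ω)⟫ ∂μ := by
            refine integral_mono_ae (((hFint k).sub (integrable_const _)).const_mul _) hDG ?_
            filter_upwards [hHbound k] with ω hb
            have hpl := polyak_lojasiewicz_of_hessian hF hlam (fun u v => (hHess u v).1)
              (w k ω) wstar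
            have hH := mul_norm_sq_le_inner_toEuclideanLin hb.1 (gradient F (w k ω))
            linarith [mul_le_mul_of_nonneg_left hpl hμ₁.le]
        _ = ∫ ω, ⟪toEuclideanLin (H k ω) (gradient F (w k ω)), (μ[g k | 𝓕 k]) ω⟫ ∂μ := by
            refine integral_congr_ae ?_
            filter_upwards [hgcond k] with ω hω
            rw [hω]
    have hnoise : ∫ ω, ‖g k ω‖ ^ 2 ∂μ ≤ γ ^ 2 := integral_le_of_condExp_le (𝓕.le k) (hg2cond k)
    have hdescent : ∫ ω, F (w (k + 1) ω) ∂μ ≤ (∫ ω, F (w k ω) ∂μ) -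
        α * (∫ ω, ⟪toEuclideanLin (H k ω) (gradient F (w k ω)), g k ω⟫ ∂μ) +
          Lam / 2 * α ^ 2 * μ₂ ^ 2 * ∫ ω, ‖g k ω‖ ^ 2 ∂μ := by
      have hint : Integrable (fun ω => F (w k ω) -
          α * ⟪toEuclideanLin (H k ω) (gradient F (w k ω)), g k ω⟫) μ :=
        (hFint k).sub (hDg.const_mul α)
      have hint2 := (hg2int k).const_mul (Lam / 2 * α ^ 2 * μ₂ ^ 2)
      rw [← integral_const_mul, ← integral_const_mul, ← integral_sub (hFint k) (hDg.const_mul α),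
        ← integral_add hint hint2]
      refine integral_mono_ae (hFint (k + 1)) (hint.add hint2) ?_
      filter_upwards [hHsymm k, hHbound k] with ω hs hb
      rw [hwrec]
      exact preconditioned_step_le hF hLam.le (fun u v => (hHess u v).2) hμ₁ hμ₁₂ hs hb.1 hb.2 α
        (w k ω) (g k ω)
    have hN : 2 * α * μ₁ * lam * (α * μ₂ ^ 2 * γ ^ 2 * Lam / (4 * μ₁ * lam)) =
        Lam / 2 * α ^ 2 * μ₂ ^ 2 * γ ^ 2 := by
      field_simp
      ring
    rw [hN]
    linarith [mul_le_mul_of_nonneg_left hcross hα.le,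
      mul_le_mul_of_nonneg_left hnoise (by positivity : 0 ≤ Lam / 2 * α ^ 2 * μ₂ ^ 2)]
  intro k
  have hk := sub_le_pow_mul_sub_of_contraction
    (u := fun k => (∫ ω, F (w k ω) ∂μ) - F wstar) hq hstep k
  simp only [hw0, integral_const, probReal_univ, one_smul] at hk
  refine ⟨hk, ?_⟩
  have := mul_nonneg (pow_nonneg (sub_nonneg.2 hq) k)
    (by positivity : 0 ≤ α * μ₂ ^ 2 * γ ^ 2 * Lam / (4 * μ₁ * lam))
  linarith
end

section
/- Let F : ℝ^d → ℝ be differentiable with ∇F Λ-Lipschitz continuous (Λ > 0). Fix w ∈ ℝ^d, a symmetric matrix H with μ₁·I ⪯ H ⪯ μ₂·I for constants 0 < μ₁ ≤ μ₂, constants γ ≥ 0 and η > 0, and a step length α with 0 < α ≤ μ₁/(μ₂² η Λ). Let g be an ℝ^d-valued random vector with E[g] = ∇F(w) and E[‖g‖²] ≤ γ² + η‖∇F(w)‖². Then E[F(w − α H g)] ≤ F(w) − (α μ₁ / 2)·‖∇F(w)‖² + (α² μ₂² γ² Λ)/2. -/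
open Matrix MeasureTheory
open scoped RealInnerProductSpace

theorem abs_sub_sub_inner_gradient_le {E : Type*} [NormedAddCommGroup E]
    [InnerProductSpace ℝ E] [CompleteSpace E] {F : E → ℝ} {Λ : ℝ}
    (hdiff : Differentiable ℝ F)
    (hlip : ∀ u v : E, ‖gradient F u - gradient F v‖ ≤ Λ * ‖u - v‖) (w v : E) :
    |F (w + v) - F w - ⟪gradient F w, v⟫| ≤ Λ / 2 * ‖v‖ ^ 2 := by
  have hderiv : ∀ t : ℝ, HasDerivAt (fun t : ℝ => F (w + t • v) - F w - t * ⟪gradient F w, v⟫)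
      ⟪gradient F (w + t • v) - gradient F w, v⟫ t := by
    intro t
    have hline : HasDerivAt (fun t : ℝ => w + t • v) v t := by
      simpa using ((hasDerivAt_id t).smul_const v).const_add w
    have hF := (hdiff (w + t • v)).hasGradientAt.hasFDerivAt.comp_hasDerivAt t hline
    have h := (hF.sub_const (F w)).sub ((hasDerivAt_id t).mul_const ⟪gradient F w, v⟫)
    refine h.congr_deriv ?_
    rw [InnerProductSpace.toDual_apply_apply, inner_sub_left, one_mul]
  have hB : ∀ t : ℝ, HasDerivAt (fun t : ℝ => Λ / 2 * ‖v‖ ^ 2 * t ^ 2) (Λ * ‖v‖ ^ 2 * t) t := by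
    intro t
    refine ((hasDerivAt_pow 2 t).const_mul (Λ / 2 * ‖v‖ ^ 2)).congr_deriv ?_
    norm_num
    ring
  have key := image_norm_le_of_norm_deriv_right_le_deriv_boundary (a := 0) (b := 1)
    (f := fun t : ℝ => F (w + t • v) - F w - t * ⟪gradient F w, v⟫)
    (fun t _ => (hderiv t).continuousAt.continuousWithinAt)
    (fun t _ => (hderiv t).hasDerivWithinAt) (by simp) hB
    (fun t ht => by
      refine (norm_inner_le_norm _ _).trans ?_
      have h := hlip (w + t • v) w
      rw [add_sub_cancel_left, norm_smul, Real.norm_of_nonneg ht.1] at h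
      nlinarith [mul_le_mul_of_nonneg_right h (norm_nonneg v)])
    (Set.right_mem_Icc.2 zero_le_one)
  simpa using key

theorem Matrix.PosSemidef.inner_toEuclideanLin_nonneg {n : Type*} [Fintype n] [DecidableEq n]
    {A : Matrix n n ℝ} (hA : A.PosSemidef) (x : EuclideanSpace ℝ n) :
    0 ≤ ⟪x, Matrix.toEuclideanLin A x⟫ :=
  (Matrix.isPositive_toEuclideanLin_iff.2 hA).inner_nonneg_right x

theorem LinearMap.IsSymmetric.norm_sq_apply_le {E : Type*} [NormedAddCommGroup E]
    [InnerProductSpace ℝ E] {T : E →ₗ[ℝ] E} (hT : T.IsSymmetric) {c : ℝ} (hc : 0 < c)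
    (h0 : ∀ x, 0 ≤ ⟪x, T x⟫) (h1 : ∀ x, ⟪x, T x⟫ ≤ c * ‖x‖ ^ 2) (x : E) :
    ‖T x‖ ^ 2 ≤ c ^ 2 * ‖x‖ ^ 2 := by
  have hy := h1 (T x)
  have hz := h0 (c • x - T x)
  have hs : ⟪x, T (T x)⟫ = ‖T x‖ ^ 2 := by rw [← hT x (T x), real_inner_self_eq_norm_sq]
  simp only [map_sub, map_smul, inner_sub_left, inner_sub_right, real_inner_smul_left,
    real_inner_smul_right, hs, real_inner_self_eq_norm_sq] at hz
  have h : ‖T x‖ ^ 2 ≤ c * ⟪x, T x⟫ := by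
    refine le_of_mul_le_mul_left ?_ hc
    linarith
  nlinarith [mul_le_mul_of_nonneg_left (h1 x) hc.le]

/-- per-iteration expected decrease in the nonconvex analysis:
if `∇F` is `Λ`-Lipschitz, `μ₁·I ⪯ H ⪯ μ₂·I` is symmetric, `0 < α ≤ μ₁/(μ₂²ηΛ)`, and `g`
is a random vector with `E[g] = ∇F(w)` and `E[‖g‖²] ≤ γ² + η‖∇F(w)‖²`, then
`E[F(w − αHg)] ≤ F(w) − (αμ₁/2)‖∇F(w)‖² + α²μ₂²γ²Λ/2`. -/
theorem stmt_15 {d : ℕ} {Ω : Type*} [MeasurableSpace Ω] (μ : Measure Ω)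
    [IsProbabilityMeasure μ]
    (F : EuclideanSpace ℝ (Fin d) → ℝ) (Λ : ℝ) (hΛ : 0 < Λ)
    (hdiff : Differentiable ℝ F)
    (hlip : ∀ u v : EuclideanSpace ℝ (Fin d),
      ‖gradient F u - gradient F v‖ ≤ Λ * ‖u - v‖)
    (w : EuclideanSpace ℝ (Fin d))
    (H : Matrix (Fin d) (Fin d) ℝ) (hHsymm : H.IsSymm)
    (μ₁ μ₂ : ℝ) (hμ₁ : 0 < μ₁) (hμ₁₂ : μ₁ ≤ μ₂)
    (hH1 : (H - μ₁ • 1).PosSemidef)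
    (hH2 : ((μ₂ • 1 : Matrix (Fin d) (Fin d) ℝ) - H).PosSemidef)
    (γ η : ℝ) (hγ : 0 ≤ γ) (hη : 0 < η)
    (α : ℝ) (hα : 0 < α) (hα2 : α ≤ μ₁ / (μ₂ ^ 2 * η * Λ))
    (g : Ω → EuclideanSpace ℝ (Fin d))
    (hgint : Integrable g μ)
    (hgmean : ∫ ω, g ω ∂μ = gradient F w)
    (hg2int : Integrable (fun ω => ‖g ω‖ ^ 2) μ)
    (hg2 : ∫ ω, ‖g ω‖ ^ 2 ∂μ ≤ γ ^ 2 + η * ‖gradient F w‖ ^ 2) :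
    ∫ ω, F (w - α • Matrix.toEuclideanLin H (g ω)) ∂μ ≤
      F w - α * μ₁ / 2 * ‖gradient F w‖ ^ 2 + α ^ 2 * μ₂ ^ 2 * γ ^ 2 * Λ / 2 := by
  have hμ₂ : 0 < μ₂ := hμ₁.trans_le hμ₁₂
  set T := Matrix.toEuclideanLin H
  have hone : ∀ (c : ℝ) (x : EuclideanSpace ℝ (Fin d)),
      ⟪x, Matrix.toEuclideanLin (c • 1 : Matrix (Fin d) (Fin d) ℝ) x⟫ = c * ‖x‖ ^ 2 := by
    intro c x
    have h : Matrix.toEuclideanLin (c • 1 : Matrix (Fin d) (Fin d) ℝ) x = c • x := by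
      ext i
      simp
    rw [h, real_inner_smul_right, real_inner_self_eq_norm_sq]
  have hlow : ∀ x, μ₁ * ‖x‖ ^ 2 ≤ ⟪x, T x⟫ := by
    intro x
    have h := hH1.inner_toEuclideanLin_nonneg x
    rw [map_sub, LinearMap.sub_apply, inner_sub_right, hone] at h
    linarith
  have hup : ∀ x, ⟪x, T x⟫ ≤ μ₂ * ‖x‖ ^ 2 := by
    intro x
    have h := hH2.inner_toEuclideanLin_nonneg x
    rw [map_sub, LinearMap.sub_apply, inner_sub_right, hone] at h
    linarith
  have hsymm : T.IsSymmetric :=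
    Matrix.isSymmetric_toEuclideanLin_iff.2 (by
      rw [Matrix.IsHermitian, Matrix.conjTranspose_eq_transpose_of_trivial]
      exact hHsymm)
  have hnorm := hsymm.norm_sq_apply_le hμ₂
    (fun x => (by positivity : (0 : ℝ) ≤ μ₁ * ‖x‖ ^ 2).trans (hlow x)) hup
  set G := gradient F w with hG
  have hstep : ∀ x, |F (w - α • T x) - F w + α * ⟪T G, x⟫| ≤
      Λ / 2 * (α ^ 2 * μ₂ ^ 2) * ‖x‖ ^ 2 := by
    intro x
    have h := abs_sub_sub_inner_gradient_le hdiff hlip w (-(α • T x))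
    rw [← sub_eq_add_neg, inner_neg_right, real_inner_smul_right, ← hG, ← hsymm G x, norm_neg,
      norm_smul, mul_pow, Real.norm_eq_abs, sq_abs, sub_neg_eq_add] at h
    refine h.trans ?_
    have hα' : 0 ≤ Λ / 2 * α ^ 2 := by positivity
    nlinarith [mul_le_mul_of_nonneg_left (hnorm x) hα']
  have hinner : Integrable (fun ω => α * ⟪T G, g ω⟫) μ := (hgint.const_inner (T G)).const_mul α
  have hlin : Integrable (fun ω => F w - α * ⟪T G, g ω⟫) μ := (integrable_const (F w)).sub hinner
  have hquad : Integrable (fun ω => Λ / 2 * (α ^ 2 * μ₂ ^ 2) * ‖g ω‖ ^ 2) μ :=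
    hg2int.const_mul _
  have hmeas : AEStronglyMeasurable (fun ω => F (w - α • T (g ω))) μ := by
    have hcont : Continuous fun x => F (w - α • T x) :=
      hdiff.continuous.comp
        (continuous_const.sub (T.continuous_of_finiteDimensional.const_smul α))
    exact hcont.comp_aestronglyMeasurable hgint.aestronglyMeasurable
  have hrem : Integrable (fun ω => F (w - α • T (g ω)) - F w + α * ⟪T G, g ω⟫) μ :=
    hquad.mono' ((hmeas.sub aestronglyMeasurable_const).add hinner.aestronglyMeasurable)
      (.of_forall fun ω => hstep (g ω))
  have hF : Integrable (fun ω => F (w - α • T (g ω))) μ := by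
    refine ((hrem.sub hinner).add (integrable_const (F w))).congr (.of_forall fun ω => ?_)
    simp only [Pi.add_apply, Pi.sub_apply]
    ring
  have hmono : ∫ ω, F (w - α • T (g ω)) ∂μ ≤
      ∫ ω, (F w - α * ⟪T G, g ω⟫ + Λ / 2 * (α ^ 2 * μ₂ ^ 2) * ‖g ω‖ ^ 2) ∂μ := by
    refine integral_mono hF (hlin.add hquad) fun ω => ?_
    have h := (abs_le.1 (hstep (g ω))).2
    dsimp only
    linarith
  rw [integral_add hlin hquad,
    integral_sub (integrable_const (F w)) hinner, integral_const_mul, integral_const_mul,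
    integral_inner hgint, hgmean, hsymm G G] at hmono
  simp only [integral_const, probReal_univ, one_smul] at hmono
  rw [le_div_iff₀ (by positivity)] at hα2
  have hc : 0 ≤ Λ / 2 * (α ^ 2 * μ₂ ^ 2) := by positivity
  have hsecond := mul_le_mul_of_nonneg_left hg2 hc
  have hfirst := mul_le_mul_of_nonneg_left (hlow G) hα.le
  have hα3 := mul_le_mul_of_nonneg_left hα2 (by positivity : 0 ≤ α / 2 * ‖G‖ ^ 2)
  linarith
end
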